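/- arXiv:2204.01068 — 5 statements merged into one kernel-verified Lean document; each statement's English description precedes it below -/
import Mathlib

section
/- Let a and b be two distinct non-constant polynomials in F_2[t], and let α_p ∈ F_2((1/t)) be the value of the infinite continued fraction whose sequence of partial quotients is the (a,b)-period-doubling sequence. Then A·α_p^4 + B·α_p^3 + C·α_p^2 + 1 = 0, where A = ab + b^2 + 1, B = ab(a + b), and C = ab. -/
/-- The continuant `⟨W⟩` of a finite word `W` with letters in a commutative ring,
defined by `⟨∅⟩ = 1`, `⟨w⟩ = w` and `⟨W⟩ = w₁⟨W'⟩ + ⟨(W')'⟩`, where `W'` is `W`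
with its first letter deleted. -/
def continuant {R : Type*} [CommRing R] : List R → R
  | [] => 1
  | [x] => x
  | x :: y :: l => x * continuant (y :: l) + continuant l

/-- The `(a,b)`-period-doubling sequence: the `n`-th term is `a` when the 2-adic
valuation of `n+1` is even, and `b` when it is odd.  (This is the fixed point
`σ^∞(a)` of the morphism `σ(a) = ab`, `σ(b) = aa`.) -/
def pdSeq {X : Type*} (a b : X) (n : ℕ) : X :=
  if Even (padicValNat 2 (n + 1)) then a else b

/-- The element `t` of `F₂((1/t))`, realized in `LaurentSeries (ZMod 2)` whose
variable `X` stands for `1/t`; thus `t = X⁻¹` is the Hahn series `single (-1) 1`. -/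
noncomputable def tt : LaurentSeries (ZMod 2) := HahnSeries.single (-1 : ℤ) 1

/-- The word of the first `n` partial quotients of the period-doubling continued
fraction, viewed inside `F₂((1/t))`. -/
noncomputable def pdQuotients (a b : Polynomial (ZMod 2)) (n : ℕ) :
    List (LaurentSeries (ZMod 2)) :=
  (List.range n).map fun i => Polynomial.aeval tt (pdSeq a b i)

/-- The `n`-th convergent `[p₀; p₁, …, pₙ]` of the period-doubling continued
fraction, expressed as the quotient of continuants `⟨p₀,…,pₙ⟩ / ⟨p₁,…,pₙ⟩`. -/
noncomputable def pdConvergent (a b : Polynomial (ZMod 2)) (n : ℕ) :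
    LaurentSeries (ZMod 2) :=
  continuant (pdQuotients a b (n + 1)) / continuant (pdQuotients a b (n + 1)).tail

open Filter Matrix

section PeriodDoubling

variable {X : Type*} (a b : X)

theorem pdSeq_two_pow_sub_one (k : ℕ) :
    pdSeq a b (2 ^ k - 1) = if Even k then a else b := by
  rw [pdSeq, Nat.sub_add_cancel Nat.one_le_two_pow, padicValNat.prime_pow]

theorem padicValNat_two_pow_add {k m : ℕ} (hm : m ≠ 0) (hmk : m < 2 ^ k) :
    padicValNat 2 (2 ^ k + m) = padicValNat 2 m := by
  obtain ⟨j, u, hu, rfl⟩ := Nat.exists_eq_two_pow_mul_odd hm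
  have hjk : j < k := by
    refine (Nat.pow_lt_pow_iff_right one_lt_two).1 (lt_of_le_of_lt ?_ hmk)
    exact Nat.le_mul_of_pos_right _ hu.pos
  obtain ⟨d, rfl⟩ := Nat.exists_eq_add_of_lt hjk
  have hsum : Odd (2 * 2 ^ d + u) := (even_two_mul _).add_odd hu
  have aux {w : ℕ} (hw : Odd w) : padicValNat 2 (2 ^ j * w) = j := by
    rw [padicValNat.mul (by positivity) hw.pos.ne', padicValNat.prime_pow,
      padicValNat.eq_zero_of_not_dvd hw.not_two_dvd_nat, add_zero]
  rw [show 2 ^ (j + d + 1) + 2 ^ j * u = 2 ^ j * (2 * 2 ^ d + u) by ring, aux hsum, aux hu]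

theorem pdSeq_two_pow_add {k m : ℕ} (hmk : m + 1 < 2 ^ k) :
    pdSeq a b (2 ^ k + m) = pdSeq a b m := by
  rw [pdSeq, pdSeq, add_assoc, padicValNat_two_pow_add m.succ_ne_zero hmk]

/-- The prefixes of length `2 ^ k - 1` of the period-doubling sequence satisfy
`P (k + 1) = P k ++ [x] ++ P k`, where `x` is `a` or `b` according to the parity of `k`. -/
theorem map_pdSeq_range_two_pow_succ_sub_one (k : ℕ) :
    (List.range (2 ^ (k + 1) - 1)).map (pdSeq a b) =
      (List.range (2 ^ k - 1)).map (pdSeq a b) ++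
        (if Even k then a else b) :: (List.range (2 ^ k - 1)).map (pdSeq a b) := by
  have h : 2 ^ (k + 1) - 1 = (2 ^ k - 1 + 1) + (2 ^ k - 1) := by
    have := Nat.one_le_two_pow (n := k)
    omega
  rw [h, List.range_add, List.range_succ, Nat.sub_add_cancel Nat.one_le_two_pow]
  simp only [List.map_append, List.map_map, List.map_cons, List.append_assoc,
    List.cons_append, List.nil_append, pdSeq_two_pow_sub_one]
  congr 2
  refine List.map_congr_left fun m hm => pdSeq_two_pow_add a b ?_
  rw [List.mem_range] at hm
  omega

end PeriodDoubling

section Continuant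

variable {R : Type*} [CommRing R]

/-- The product of the matrices `!![w, 1; 1, 0]` over the letters `w` of a word. -/
def continuantMatrix (l : List R) : Matrix (Fin 2) (Fin 2) R :=
  (l.map fun w => !![w, 1; 1, 0]).prod

theorem continuantMatrix_append_cons (l₁ l₂ : List R) (x : R) :
    continuantMatrix (l₁ ++ x :: l₂) =
      continuantMatrix l₁ * !![x, 1; 1, 0] * continuantMatrix l₂ := by
  simp [continuantMatrix, mul_assoc]

theorem continuantMatrix_cons_apply (l : List R) (x : R) :
    continuantMatrix (x :: l) 0 0 = continuant (x :: l) ∧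
      continuantMatrix (x :: l) 1 0 = continuant l := by
  induction l generalizing x with
  | nil => simp [continuantMatrix, continuant]
  | cons y l ih =>
    have h : continuantMatrix (x :: y :: l) = !![x, 1; 1, 0] * continuantMatrix (y :: l) := by
      simp [continuantMatrix]
    simp [h, Matrix.mul_apply, Fin.sum_univ_two, ih, continuant]

theorem continuantMatrix_apply {l : List R} (hl : l ≠ []) :
    continuantMatrix l 0 0 = continuant l ∧ continuantMatrix l 1 0 = continuant l.tail := by
  obtain ⟨x, l, rfl⟩ := List.exists_cons_of_ne_nil hl
  exact continuantMatrix_cons_apply l x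

end Continuant

section Recursion

variable {R : Type*} [CommRing R] (a b : R)

/-- In characteristic two, the continuants of the prefix of length `2 ^ k - 1` of the
period-doubling sequence and of that prefix without its first letter. -/
def pdCont : ℕ → R × R
  | 0 => (1, 0)
  | k + 1 =>
    ((if Even k then a else b) * (pdCont k).1 ^ 2,
      (if Even k then a else b) * (pdCont k).1 * (pdCont k).2 + 1)

theorem continuantMatrix_pdSeq [CharP R 2] (k : ℕ) :
    ∃ r, continuantMatrix ((List.range (2 ^ k - 1)).map (pdSeq a b)) =
        !![(pdCont a b k).1, (pdCont a b k).2; (pdCont a b k).2, r] ∧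
      (pdCont a b k).1 * r + (pdCont a b k).2 ^ 2 = 1 := by
  induction k with
  | zero => exact ⟨1, by simp [continuantMatrix, pdCont, Matrix.one_fin_two], by simp [pdCont]⟩
  | succ k ih =>
    obtain ⟨r, hM, hdet⟩ := ih
    rw [map_pdSeq_range_two_pow_succ_sub_one, continuantMatrix_append_cons, hM]
    simp only [pdCont]
    generalize (if Even k then a else b) = x
    generalize (pdCont a b k).1 = p at *
    generalize (pdCont a b k).2 = q at *
    refine ⟨x * q ^ 2, ?_, by grind⟩
    ext i j
    fin_cases i <;> fin_cases j <;> simp [Matrix.mul_apply, Fin.sum_univ_two] <;> grind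

theorem pdCont_quartic [CharP R 2] (m : ℕ) :
    (a * b + b ^ 2 + 1) * (pdCont a b (2 * m)).1 ^ 4
      + a * b * (a + b) * (pdCont a b (2 * m)).1 ^ 3 * (pdCont a b (2 * m)).2
      + a * b * (pdCont a b (2 * m)).1 ^ 2 * (pdCont a b (2 * m)).2 ^ 2
      + (pdCont a b (2 * m)).2 ^ 4 = 1 + b * (a + b) * (pdCont a b (2 * m)).1 ^ 2 := by
  induction m with
  | zero =>
    simp only [pdCont]
    ring
  | succ m ih =>
    have h : ¬ Even (2 * m + 1) := by simp
    simp only [mul_add, mul_one, pdCont, even_two_mul, h, if_true, if_false] at ih ⊢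
    generalize (pdCont a b (2 * m)).1 = p at *
    generalize (pdCont a b (2 * m)).2 = q at *
    grind

end Recursion

section Valuation

variable {R Γ : Type*} [CommRing R] [LinearOrderedCommGroupWithZero Γ] (v : Valuation R Γ)
  {a b : R} {T : Γ}

theorem pow_le_valuation_pdCont_fst (hT : 1 < T) (ha : T ≤ v a) (hb : T ≤ v b) (k : ℕ) :
    T ^ k ≤ v (pdCont a b k).1 := by
  induction k with
  | zero => simp [pdCont]
  | succ k ih =>
    have hx : T ≤ v (if Even k then a else b) := by split_ifs <;> assumption
    simp only [pdCont, map_mul, map_pow]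
    calc T ^ (k + 1) = T * T ^ k := pow_succ' T k
      _ ≤ v (if Even k then a else b) * v (pdCont a b k).1 := mul_le_mul' hx ih
      _ ≤ v (if Even k then a else b) * v (pdCont a b k).1 ^ 2 :=
        mul_le_mul' le_rfl (le_self_pow₀ ((one_le_pow₀ hT.le).trans ih) two_ne_zero)

theorem one_le_valuation_pdCont_snd (hT : 1 < T) (ha : T ≤ v a) (hb : T ≤ v b) (k : ℕ) :
    1 ≤ v (pdCont a b (k + 1)).2 := by
  induction k with
  | zero => simp [pdCont]
  | succ k ih =>
    have hx : 1 < v (if Even (k + 1) then a else b) :=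
      hT.trans_le (by split_ifs <;> assumption)
    have hp : 1 ≤ v (pdCont a b (k + 1)).1 :=
      (one_le_pow₀ hT.le).trans (pow_le_valuation_pdCont_fst v hT ha hb (k + 1))
    rw [pdCont]
    generalize (if Even (k + 1) then a else b) = x at *
    generalize (pdCont a b (k + 1)).1 = p at *
    generalize (pdCont a b (k + 1)).2 = q at *
    have h : 1 < v (x * p * q) := by
      rw [map_mul, map_mul]
      exact (hx.trans_le (le_mul_of_one_le_right' hp)).trans_le (le_mul_of_one_le_right' ih)
    rw [Valuation.map_add_eq_of_lt_left v (by simpa using h)]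
    exact h.le

end Valuation

theorem one_lt_valuation_tt : 1 < (Valued.v tt : WithZero (Multiplicative ℤ)) := by
  rw [tt, LaurentSeries.valuation_single_zpow, ← WithZero.exp_zero, WithZero.exp_lt_exp]
  simp

theorem valuation_tt_le_valuation_aeval {a : Polynomial (ZMod 2)} (ha : 0 < a.natDegree) :
    (Valued.v tt : WithZero (Multiplicative ℤ)) ≤ Valued.v (Polynomial.aeval tt a) := by
  have : (Valued.v (R := LaurentSeries (ZMod 2)) (Γ₀ := WithZero (Multiplicative ℤ))).IsTrivialOn
      (ZMod 2) := ⟨fun x hx => by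
    obtain rfl : x = 1 := Fin.eq_one_of_ne_zero x hx
    simp⟩
  rw [Polynomial.valuation_aeval_eq_valuation_X_pow_natDegree_of_one_lt_valuation_X tt
    one_lt_valuation_tt (Polynomial.ne_zero_of_natDegree_gt ha)]
  exact le_self_pow₀ one_lt_valuation_tt.le ha.ne'

instance : CharP (LaurentSeries (ZMod 2)) 2 :=
  charP_of_injective_ringHom (algebraMap (ZMod 2) (LaurentSeries (ZMod 2))).injective 2

theorem pdConvergent_two_pow_sub_two (a b : Polynomial (ZMod 2)) {k : ℕ} (hk : k ≠ 0) :
    pdConvergent a b (2 ^ k - 2) =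
      (pdCont (Polynomial.aeval tt a) (Polynomial.aeval tt b) k).1 /
        (pdCont (Polynomial.aeval tt a) (Polynomial.aeval tt b) k).2 := by
  have h2 : 2 ≤ 2 ^ k := le_self_pow₀ one_le_two hk
  have hmap (n : ℕ) : pdQuotients a b n =
      (List.range n).map (pdSeq (Polynomial.aeval tt a) (Polynomial.aeval tt b)) :=
    List.map_congr_left fun i _ => by simp only [pdSeq, apply_ite (Polynomial.aeval tt)]
  obtain ⟨r, hM, -⟩ :=
    continuantMatrix_pdSeq (Polynomial.aeval tt a) (Polynomial.aeval tt b) k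
  have hne : (List.range (2 ^ k - 1)).map
      (pdSeq (Polynomial.aeval tt a) (Polynomial.aeval tt b)) ≠ [] := by
    simp only [ne_eq, List.map_eq_nil_iff, List.range_eq_nil]
    omega
  obtain ⟨h₀, h₁⟩ := continuantMatrix_apply hne
  rw [pdConvergent, show 2 ^ k - 2 + 1 = 2 ^ k - 1 by omega, hmap, ← h₀, ← h₁, hM]
  simp

theorem tendsto_inv_pdCont_fst {K Γ : Type*} [Field K] [LinearOrderedCommGroupWithZero Γ]
    [MulArchimedean Γ] [Valued K Γ] {a b t : K} (ht : 1 < (Valued.v t : Γ))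
    (ha : (Valued.v t : Γ) ≤ Valued.v a) (hb : (Valued.v t : Γ) ≤ Valued.v b) :
    Tendsto (fun k => (pdCont a b k).1⁻¹) atTop (nhds 0) := by
  have h := Valued.tendsto_zero_pow_of_v_lt_one (x := t⁻¹) (Γ₀ := Γ)
    (by rw [map_inv₀]; exact inv_lt_one_of_one_lt₀ ht)
  rw [(Valued.hasBasis_nhds_zero K Γ).tendsto_right_iff] at h ⊢
  intro γ hγ
  filter_upwards [h γ hγ] with k hk
  refine lt_of_le_of_lt ?_ hk
  rw [Valuation.restrict_le_iff, inv_pow, map_inv₀, map_inv₀, map_pow]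
  exact inv_anti₀ (pow_pos (zero_lt_one.trans ht) k)
    (pow_le_valuation_pdCont_fst Valued.v ht ha hb k)

/-- **Theorem 1.** Let `a ≠ b` be non-constant polynomials in `F₂[t]` and let
`α_p ∈ F₂((1/t))` be the value of the continued fraction whose partial quotients
form the `(a,b)`-period-doubling sequence.  Then
`A·α_p⁴ + B·α_p³ + C·α_p² + 1 = 0` with `A = ab + b² + 1`, `B = ab(a+b)`, `C = ab`. -/
theorem period_doubling_CF_algebraic
    (a b : Polynomial (ZMod 2)) (hab : a ≠ b)
    (ha : 0 < a.natDegree) (hb : 0 < b.natDegree)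
    (α : LaurentSeries (ZMod 2))
    (hα : Filter.Tendsto (pdConvergent a b) Filter.atTop (nhds α)) :
    Polynomial.aeval tt (a * b + b ^ 2 + 1) * α ^ 4
      + Polynomial.aeval tt (a * b * (a + b)) * α ^ 3
      + Polynomial.aeval tt (a * b) * α ^ 2 + 1 = 0 := by
  have hT := one_lt_valuation_tt
  have hva := valuation_tt_le_valuation_aeval ha
  have hvb := valuation_tt_le_valuation_aeval hb
  simp only [map_add, map_mul, map_pow, map_one]
  set x := Polynomial.aeval tt a
  set y := Polynomial.aeval tt b
  have hk : Tendsto (fun m : ℕ => 2 * (m + 1)) atTop atTop :=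
    tendsto_atTop_mono (fun m => show m ≤ 2 * (m + 1) by omega) tendsto_id
  have hn : Tendsto (fun m : ℕ => 2 ^ (2 * (m + 1)) - 2) atTop atTop :=
    tendsto_atTop_mono (fun m => show m ≤ 2 ^ (2 * (m + 1)) - 2 by
      have := Nat.lt_two_pow_self (n := 2 * (m + 1))
      omega) tendsto_id
  have hu : Tendsto (fun m : ℕ => (pdCont x y (2 * (m + 1))).1 / (pdCont x y (2 * (m + 1))).2)
      atTop (nhds α) :=
    (hα.comp hn).congr fun m => pdConvergent_two_pow_sub_two a b (by simp)
  have hδ : Tendsto (fun m : ℕ => (pdCont x y (2 * (m + 1))).1⁻¹) atTop (nhds 0) :=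
    (tendsto_inv_pdCont_fst hT hva hvb).comp hk
  have hL := ((((hu.pow 4).const_mul (x * y + y ^ 2 + 1)).add
    ((hu.pow 3).const_mul (x * y * (x + y)))).add ((hu.pow 2).const_mul (x * y))).add_const 1
  have hR := (hu.pow 4).mul ((hδ.pow 4).add ((hδ.pow 2).const_mul (y * (x + y))))
  refine (tendsto_nhds_unique (hL.congr fun m => ?_) hR).trans (by simp)
  have hp : (pdCont x y (2 * (m + 1))).1 ≠ 0 := (Valuation.ne_zero_iff Valued.v).1
    ((pow_pos (zero_lt_one.trans hT) _).trans_le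
      (pow_le_valuation_pdCont_fst Valued.v hT hva hvb _)).ne'
  have hq : (pdCont x y (2 * (m + 1))).2 ≠ 0 := (Valuation.ne_zero_iff Valued.v).1
    (zero_lt_one.trans_le (one_le_valuation_pdCont_snd Valued.v hT hva hvb _)).ne'
  have h := pdCont_quartic x y (m + 1)
  field_simp
  linear_combination h
end

section
/- Let a and b be two distinct non-constant polynomials in F_2[t], and set A = ab + b^2 + 1, B = ab(a + b), C = ab. Then the polynomial P(x) = A·x^4 + B·x^3 + C·x^2 + 1 has no root in the rational function field F_2(t). -/
open Polynomial in
/-- The system `r² = b s`, `(s + 1)² = a r` has no solutions over `F₂[t]` when `a` is non-constant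
and `b` is nonzero: `s` divides `(s + 1)⁴`, hence is a unit. -/
theorem no_solution_sq_eq_mul_of_natDegree_pos
    {a b r s : (ZMod 2)[X]} (ha : 0 < a.natDegree) (hb : b ≠ 0)
    (hr : r ^ 2 = b * s) (hs : (s + 1) ^ 2 = a * r) : False := by
  have ha0 : a ≠ 0 := by
    rintro rfl
    simp at ha
  have hdvd : s ∣ 1 :=
    ⟨a ^ 2 * b - (s ^ 3 + 4 * s ^ 2 + 6 * s + 4), by
      linear_combination ((s + 1) ^ 2 + a * r) * hs + a ^ 2 * hr⟩
  obtain ⟨k, hk, rfl⟩ := Polynomial.isUnit_iff.mp (isUnit_of_dvd_one hdvd)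
  have hk1 : ∀ k : ZMod 2, k ≠ 0 → k + 1 = 0 := by decide
  have hs0 : (C k + 1 : (ZMod 2)[X]) = 0 := by
    rw [← C_1, ← C_add, hk1 k hk.ne_zero, C_0]
  rw [hs0, zero_pow two_ne_zero, eq_comm, mul_eq_zero, or_iff_right ha0] at hs
  rw [hs, zero_pow two_ne_zero, eq_comm, mul_eq_zero, or_iff_right hb, C_eq_zero] at hr
  exact hk.ne_zero hr

/-- An element of the fraction field of an integrally closed domain that satisfies a monic
quadratic equation over the domain lies in the domain. -/
theorem IsIntegrallyClosed.exists_algebraMap_eq_of_quadratic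
    {R K : Type*} [CommRing R] [IsDomain R] [Field K] [Algebra R K] [IsFractionRing R K]
    [IsIntegrallyClosed R]
    {p q : R} {z : K} (hz : z ^ 2 + algebraMap R K p * z + algebraMap R K q = 0) :
    ∃ w : R, algebraMap R K w = z := by
  refine IsIntegrallyClosed.isIntegral_iff.mp
    ⟨.X ^ 2 + (.C p * .X + .C q), Polynomial.monic_X_pow_add ?_, ?_⟩
  · exact Polynomial.degree_linear_le.trans_lt (by norm_num)
  · simpa [Polynomial.eval₂_add, Polynomial.eval₂_mul, add_assoc] using hz

/-- An element of the fraction field of an integrally closed domain that satisfies a monic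
quartic equation without cubic term over the domain lies in the domain. -/
theorem IsIntegrallyClosed.exists_algebraMap_eq_of_depressed_quartic
    {R K : Type*} [CommRing R] [IsDomain R] [Field K] [Algebra R K] [IsFractionRing R K]
    [IsIntegrallyClosed R]
    {p q r : R} {z : K}
    (hz : z ^ 4 + algebraMap R K p * z ^ 2 + algebraMap R K q * z + algebraMap R K r = 0) :
    ∃ w : R, algebraMap R K w = z := by
  refine IsIntegrallyClosed.isIntegral_iff.mp
    ⟨.X ^ 4 + (.C p * .X ^ 2 + .C q * .X + .C r), Polynomial.monic_X_pow_add ?_, ?_⟩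
  · exact Polynomial.degree_quadratic_le.trans_lt (by norm_num)
  · simpa [Polynomial.eval₂_add, Polynomial.eval₂_mul, add_assoc] using hz


/-- Let `a ≠ b` be non-constant polynomials in `F₂[t]` and set
`A = ab + b² + 1`, `B = ab(a+b)`, `C = ab`.  Then the polynomial
`P(x) = A·x⁴ + B·x³ + C·x² + 1` has no root in the rational function
field `F₂(t)`. -/
theorem pd_polynomial_has_no_rational_root
    (a b : Polynomial (ZMod 2)) (hab : a ≠ b)
    (ha : 0 < a.natDegree) (hb : 0 < b.natDegree) :
    ∀ x : RatFunc (ZMod 2),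
      algebraMap (Polynomial (ZMod 2)) (RatFunc (ZMod 2)) (a * b + b ^ 2 + 1) * x ^ 4
        + algebraMap (Polynomial (ZMod 2)) (RatFunc (ZMod 2)) (a * b * (a + b)) * x ^ 3
        + algebraMap (Polynomial (ZMod 2)) (RatFunc (ZMod 2)) (a * b) * x ^ 2 + 1 ≠ 0 := by
  intro x hx
  set φ := algebraMap (Polynomial (ZMod 2)) (RatFunc (ZMod 2)) with hφ
  have hinj : Function.Injective φ := IsFractionRing.injective _ _
  have hb0 : b ≠ 0 := by
    rintro rfl
    simp at hb
  have h2 : (2 : Polynomial (ZMod 2)) = 0 := CharTwo.two_eq_zero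
  have hφ2 : (2 : RatFunc (ZMod 2)) = 0 := by simpa only [map_ofNat, map_zero] using congrArg φ h2
  have hc : φ a + φ b ≠ 0 := by
    intro h
    refine hab (hinj ?_)
    linear_combination h - φ b * hφ2
  have hx0 : x ≠ 0 := by
    rintro rfl
    simp at hx
  obtain ⟨y, hy⟩ : ∃ y, φ y = x⁻¹ := by
    refine IsIntegrallyClosed.exists_algebraMap_eq_of_depressed_quartic
      (p := a * b) (q := a * b * (a + b)) (r := a * b + b ^ 2 + 1) ?_
    rw [← hφ]
    field_simp
    linear_combination hx
  have hy4 : φ y ^ 4 + φ a * φ b * φ y ^ 2 + φ a * φ b * (φ a + φ b) * φ y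
      + (φ a * φ b + φ b ^ 2 + 1) = 0 := by
    simp only [map_add, map_mul, map_pow, map_one] at hx
    rw [hy]
    field_simp
    linear_combination hx
  obtain ⟨s, hs⟩ : ∃ s, φ s = (φ y ^ 2 + φ a * φ y + 1) / (φ a + φ b) := by
    refine IsIntegrallyClosed.exists_algebraMap_eq_of_quadratic
      (p := a) (q := 1 + a * y) ?_
    rw [← hφ]
    simp only [map_add, map_mul, map_one]
    field_simp
    grind
  have hcs : (a + b) * s = y ^ 2 + a * y + 1 := by
    apply hinj
    simp only [map_add, map_mul, map_one, map_pow]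
    rw [hs]
    field_simp
  have hsq : s ^ 2 + a * s + 1 + a * y = 0 := by
    apply hinj
    simp only [map_add, map_mul, map_one, map_pow, map_zero]
    rw [hs]
    field_simp
    grind
  refine no_solution_sq_eq_mul_of_natDegree_pos (r := y + s) (s := s) ha hb0 ?_ ?_
  · grind
  · grind
end

section
/- Let a and b be two distinct non-constant polynomials in F_2[t], and set A = ab + b^2 + 1, B = ab(a + b), C = ab. Then the polynomial P(x) = A·x^4 + B·x^3 + C·x^2 + 1 is irreducible over the rational function field F_2(t). -/
/-- In an integrally closed domain, `v` divides `w` as soon as `w / v` satisfies a monic quadratic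
equation. -/
theorem IsIntegrallyClosed.dvd_of_sq_add_mul_add_sq_mul_eq_zero {R : Type*} [CommRing R]
    [IsDomain R] [IsIntegrallyClosed R] {v w s r : R}
    (h : w ^ 2 + v * s * w + v ^ 2 * r = 0) : v ∣ w := by
  by_cases hv : v = 0
  · subst hv
    have : w ^ 2 = 0 := by linear_combination h
    simpa using this
  have hv' : algebraMap R (FractionRing R) v ≠ 0 := by simpa using hv
  have hint : IsIntegral R (algebraMap R (FractionRing R) w / algebraMap R (FractionRing R) v) := by
    refine ⟨Polynomial.X ^ 2 + Polynomial.C s * Polynomial.X + Polynomial.C r, by monicity!, ?_⟩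
    have h' := congrArg (algebraMap R (FractionRing R)) h
    simp only [map_add, map_mul, map_pow, map_zero] at h'
    simp only [Polynomial.eval₂_add, Polynomial.eval₂_mul, Polynomial.eval₂_pow,
      Polynomial.eval₂_X, Polynomial.eval₂_C]
    field_simp
    linear_combination h'
  obtain ⟨y, hy⟩ := IsIntegrallyClosed.isIntegral_iff.1 hint
  refine ⟨y, IsFractionRing.injective R (FractionRing R) ?_⟩
  rw [map_mul, hy]
  field_simp

namespace Polynomial

theorem natDegree_reverse_of_coeff_zero_ne_zero {R : Type*} [Semiring R] {f : R[X]}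
    (hf : f.coeff 0 ≠ 0) : f.reverse.natDegree = f.natDegree := by
  rw [reverse_natDegree, natTrailingDegree_eq_zero.2 (Or.inr hf), Nat.sub_zero]

theorem reverse_reverse_of_coeff_zero_ne_zero {R : Type*} [Semiring R] {f : R[X]}
    (hf : f.coeff 0 ≠ 0) : f.reverse.reverse = f := by
  rw [reverse, natDegree_reverse_of_coeff_zero_ne_zero hf, reverse, reflect_reflect]

theorem isUnit_of_isUnit_reverse {K : Type*} [Field K] {f : K[X]} (h0 : f.coeff 0 ≠ 0)
    (hf : IsUnit f.reverse) : IsUnit f := by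
  have hdeg := natDegree_eq_zero_of_isUnit hf
  rw [natDegree_reverse_of_coeff_zero_ne_zero h0] at hdeg
  rw [eq_C_of_natDegree_eq_zero hdeg]
  exact isUnit_C.2 (isUnit_iff_ne_zero.2 h0)

theorem irreducible_reverse {K : Type*} [Field K] {f : K[X]} (h0 : f.coeff 0 ≠ 0)
    (hf : Irreducible f) : Irreducible f.reverse := by
  refine ⟨fun h => hf.not_isUnit (isUnit_of_isUnit_reverse h0 h), fun g h hgh => ?_⟩
  have hlead : g.coeff 0 * h.coeff 0 ≠ 0 := by
    rw [← mul_coeff_zero, ← hgh, coeff_zero_reverse]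
    exact leadingCoeff_ne_zero.2 hf.ne_zero
  have hfac : f = g.reverse * h.reverse := by
    rw [← reverse_mul_of_domain, ← hgh, reverse_reverse_of_coeff_zero_ne_zero h0]
  exact (hf.isUnit_or_isUnit hfac).imp
    (isUnit_of_isUnit_reverse (left_ne_zero_of_mul hlead))
    (isUnit_of_isUnit_reverse (right_ne_zero_of_mul hlead))

theorem Monic.eq_X_sq_add_C_mul_X_add_C {R : Type*} [Semiring R] {f : R[X]} (hf : f.Monic)
    (hdeg : f.natDegree = 2) : f = X ^ 2 + C (f.coeff 1) * X + C (f.coeff 0) := by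
  conv_lhs => rw [hf.as_sum, hdeg]
  simp [Finset.sum_range_succ, add_assoc, add_comm (C (f.coeff 0))]

theorem eq_one_of_isUnit_zmod_two {f : (ZMod 2)[X]} (hf : IsUnit f) : f = 1 := by
  obtain ⟨c, hc, rfl⟩ := Polynomial.isUnit_iff.1 hf
  have : ∀ c : ZMod 2, c ≠ 0 → c = 1 := by decide
  rw [this c hc.ne_zero, C_1]

/-- The reciprocal quartic `y⁴ + ab y² + ab(a+b) y + ab + b² + 1` has no root in `F₂[t]`. -/
theorem reciprocal_quartic_ne_zero {a b : (ZMod 2)[X]} (ha : a ≠ 0) (hb : b ≠ 0) (hab : a ≠ b)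
    (y : (ZMod 2)[X]) :
    y ^ 4 + a * b * y ^ 2 + a * b * (a + b) * y + (a * b + b ^ 2 + 1) ≠ 0 := by
  intro h
  have two : (2 : (ZMod 2)[X]) = 0 := CharTwo.two_eq_zero
  obtain ⟨d, rfl⟩ : ∃ d, a = b + d := ⟨a - b, by ring⟩
  obtain ⟨W, hW⟩ : d ∣ y ^ 2 + b * y + 1 := by
    apply IsIntegrallyClosed.dvd_of_sq_add_mul_add_sq_mul_eq_zero (s := b) (r := b * y)
    grind
  have hd : d ≠ 0 := by rintro rfl; simp at hab
  have hW2 : W ^ 2 + b * (W + y) = 0 := by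
    apply mul_left_cancel₀ (pow_ne_zero 2 hd)
    grind
  obtain ⟨c, hc⟩ : b ∣ W ^ 2 := ⟨W + y, by grind⟩
  have hy : y = c + W := by
    apply mul_left_cancel₀ hb
    grind
  have hcop : IsCoprime c W := ⟨c, d + b, by grind⟩
  obtain rfl : c = 1 := eq_one_of_isUnit_zmod_two <|
    hcop.pow_right.isUnit_of_dvd' dvd_rfl ⟨b, by rw [hc, mul_comm]⟩
  have hW0 : W ≠ 0 := by
    rintro rfl
    exact hb (by simpa using hc.symm)
  refine ha (mul_left_cancel₀ hW0 ?_)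
  grind

/-- The reciprocal quartic `y⁴ + ab y² + ab(a+b) y + ab + b² + 1` is not a product
`(y² + py + q)(y² + py + r)` over `F₂[t]`. -/
theorem reciprocal_quartic_no_quadratic_factors {a b p q r : (ZMod 2)[X]} (ha : a ≠ 0) (hb : b ≠ 0)
    (hab : a ≠ b) (h2 : q + r + p ^ 2 = a * b) (h1 : p * (q + r) = a * b * (a + b))
    (h0 : q * r = a * b + b ^ 2 + 1) : False := by
  have two : (2 : (ZMod 2)[X]) = 0 := CharTwo.two_eq_zero
  have hd : a + b ≠ 0 := fun h => hab (CharTwo.add_eq_zero.1 h)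
  have hv : p + b ≠ 0 := by
    intro h
    have hp : p = b := CharTwo.add_eq_zero.1 h
    subst hp
    refine mul_ne_zero hb (pow_ne_zero 2 hd) ?_
    grind
  have hcurve : p ^ 3 + a * b * p + a * b * (a + b) = 0 := by grind
  have hcube : (p ^ 2 + a * b) ^ 3 = (p + b) ^ 3 * (a ^ 2 * b) := by grind
  obtain ⟨s, hs⟩ : p + b ∣ p ^ 2 + a * b :=
    (IsIntegrallyClosed.pow_dvd_pow_iff three_ne_zero).1 ⟨_, hcube⟩
  have hs0 : s ≠ 0 := by
    rintro rfl
    rw [hs, mul_zero, zero_pow three_ne_zero] at hcube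
    exact mul_ne_zero (pow_ne_zero 3 hv) (mul_ne_zero (pow_ne_zero 2 ha) hb) hcube.symm
  have hw : (q + 1) ^ 2 + (p + b) * s * (q + 1) + (p + b) ^ 2 * 1 = 0 := by
    rw [← hs]
    linear_combination q * h2 - h0 + (q + q * a * b + p ^ 2 + p * b) * two
  obtain ⟨f, hf⟩ := IsIntegrallyClosed.dvd_of_sq_add_mul_add_sq_mul_eq_zero hw
  have hfs : f ^ 2 + s * f + 1 = 0 := by
    apply mul_left_cancel₀ (pow_ne_zero 2 hv)
    rw [hf] at hw
    linear_combination hw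
  obtain rfl : f = 1 := eq_one_of_isUnit_zmod_two <|
    IsUnit.of_mul_eq_one (f + s) (by linear_combination hfs - two)
  exact hs0 (by linear_combination hfs - two)

theorem irreducible_reciprocal_quartic {a b : (ZMod 2)[X]} (ha : a ≠ 0) (hb : b ≠ 0)
    (hab : a ≠ b) :
    Irreducible (X ^ 4 + C (a * b) * X ^ 2 + C (a * b * (a + b)) * X
      + C (a * b + b ^ 2 + 1)) := by
  set Q : (ZMod 2)[X][X] := X ^ 4 + C (a * b) * X ^ 2 + C (a * b * (a + b)) * X
      + C (a * b + b ^ 2 + 1) with hQ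
  have hdeg : Q.natDegree = 4 := by rw [hQ]; compute_degree!
  have hmonic : Q.Monic := by rw [hQ]; monicity!
  refine hmonic.irreducible_iff_natDegree'.2 ⟨fun h => by simp [h] at hdeg, ?_⟩
  intro f g hf hg hfg hmem
  have hsum : f.natDegree + g.natDegree = 4 := by rw [← hf.natDegree_mul hg, hfg, hdeg]
  rw [hdeg, Finset.mem_Ioc] at hmem
  obtain hg1 | hg2 : g.natDegree = 1 ∨ g.natDegree = 2 := by omega
  · have hroot : Q.eval (g.coeff 0) = 0 := by
      rw [← hfg, eval_mul, hg.eq_X_add_C hg1]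
      simp [CharTwo.add_self_eq_zero]
    refine reciprocal_quartic_ne_zero ha hb hab (g.coeff 0) ?_
    simpa [hQ] using hroot
  · have hf2 : f.natDegree = 2 := by omega
    obtain ⟨p, q, hfe⟩ : ∃ p q, f = X ^ 2 + C p * X + C q :=
      ⟨_, _, hf.eq_X_sq_add_C_mul_X_add_C hf2⟩
    obtain ⟨p', r, hge⟩ : ∃ p r, g = X ^ 2 + C p * X + C r :=
      ⟨_, _, hg.eq_X_sq_add_C_mul_X_add_C hg2⟩
    have hexp : X ^ 4 + C (p + p') * X ^ 3 + C (q + r + p * p') * X ^ 2 + C (p * r + q * p') * X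
        + C (q * r) = Q := by
      rw [← hfg, hfe, hge]
      simp only [map_add, map_mul]
      ring
    have e3 := congrArg (fun P => P.coeff 3) hexp
    have e2 := congrArg (fun P => P.coeff 2) hexp
    have e1 := congrArg (fun P => P.coeff 1) hexp
    have e0 := congrArg (fun P => P.coeff 0) hexp
    simp [hQ, coeff_X, coeff_C, coeff_X_pow, -map_add, -map_mul] at e3 e2 e1 e0
    obtain rfl : p = p' := CharTwo.add_eq_zero.1 e3
    exact reciprocal_quartic_no_quadratic_factors (p := p) (q := q) (r := r) ha hb hab
      (by linear_combination e2) (by linear_combination e1) e0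

end Polynomial

open Polynomial in
/-- Let `a ≠ b` be non-constant polynomials in `F₂[t]` and set
`A = ab + b² + 1`, `B = ab(a+b)`, `C = ab`.  Then the polynomial
`P(x) = A·x⁴ + B·x³ + C·x² + 1` is irreducible over the rational function
field `F₂(t)`. -/
theorem pd_polynomial_irreducible
    (a b : Polynomial (ZMod 2)) (hab : a ≠ b)
    (ha : 0 < a.natDegree) (hb : 0 < b.natDegree) :
    Irreducible
      (C (algebraMap (Polynomial (ZMod 2)) (RatFunc (ZMod 2)) (a * b + b ^ 2 + 1)) * X ^ 4
        + C (algebraMap (Polynomial (ZMod 2)) (RatFunc (ZMod 2)) (a * b * (a + b))) * X ^ 3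
        + C (algebraMap (Polynomial (ZMod 2)) (RatFunc (ZMod 2)) (a * b)) * X ^ 2 + 1 :
        Polynomial (RatFunc (ZMod 2))) := by
  have ha0 : a ≠ 0 := ne_zero_of_natDegree_gt ha
  have hb0 : b ≠ 0 := ne_zero_of_natDegree_gt hb
  have hA : a * b + b ^ 2 + 1 ≠ 0 := by
    simpa using reciprocal_quartic_ne_zero ha0 hb0 hab 0
  have hmonic : (X ^ 4 + C (a * b) * X ^ 2 + C (a * b * (a + b)) * X
      + C (a * b + b ^ 2 + 1)).Monic := by monicity!
  have hirr := (hmonic.irreducible_iff_irreducible_map_fraction_map (K := RatFunc (ZMod 2))).1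
    (irreducible_reciprocal_quartic ha0 hb0 hab)
  set φ := algebraMap (ZMod 2)[X] (RatFunc (ZMod 2))
  have hcoeff : (map φ (X ^ 4 + C (a * b) * X ^ 2 + C (a * b * (a + b)) * X
      + C (a * b + b ^ 2 + 1))).coeff 0 ≠ 0 := by
    rw [coeff_map, coeff_zero_eq_eval_zero]
    simpa [-map_add, -map_mul, -map_pow, φ] using hA
  convert irreducible_reverse hcoeff hirr using 1
  have hdeg : (map φ (X ^ 4 + C (a * b) * X ^ 2 + C (a * b * (a + b)) * X
      + C (a * b + b ^ 2 + 1))).natDegree = 4 := by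
    rw [hmonic.natDegree_map]
    compute_degree!
  rw [reverse, hdeg]
  simp only [Polynomial.map_add, Polynomial.map_mul, Polynomial.map_pow, map_X, map_C,
    reflect_add, reflect_C_mul_X_pow, reflect_monomial, reflect_C]
  rw [← pow_one (X : (RatFunc (ZMod 2))[X]), reflect_C_mul_X_pow]
  simp [revAt_le, -map_add, -map_mul]
  ring
end

section
/- For every n ≥ 0, the word W_{n+1} equals the concatenation W_n, ε_n, W_n, where ε_n = a if n is even and ε_n = b if n is odd. -/
theorem List.iterate_flatMap_append {X : Type*} (σ : X → List X) (n : ℕ) (u v : List X) :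
    (fun l : List X => l.flatMap σ)^[n] (u ++ v) =
      (fun l : List X => l.flatMap σ)^[n] u ++ (fun l : List X => l.flatMap σ)^[n] v := by
  induction n generalizing u v with
  | zero => rfl
  | succ n ih => simp only [Function.iterate_succ_apply, List.flatMap_append, ih]

/-- The iterated images of the two letters under the period-doubling morphism differ only
in their last letter. -/
theorem exists_common_prefix_iterate_flatMap {X : Type*} (a b : X) (σ : X → List X)
    (hσa : σ a = [a, b]) (hσb : σ b = [a, a]) (n : ℕ) :
    ∃ P : List X,
      (fun l : List X => l.flatMap σ)^[n] [a] = P ++ [if Even n then a else b] ∧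
      (fun l : List X => l.flatMap σ)^[n] [b] = P ++ [if Even n then b else a] := by
  induction n with
  | zero => exact ⟨[], by simp⟩
  | succ n ih =>
    obtain ⟨P, ha, hb⟩ := ih
    refine ⟨P.flatMap σ ++ [a], ?_⟩
    simp only [Function.iterate_succ_apply', ha, hb, Nat.even_add_one]
    by_cases h : Even n <;> simp [h, hσa, hσb]

/-- **Lemma 3.1.**  Let `{a, b}` be a two-letter alphabet and `σ` the morphism
with `σ(a) = ab`, `σ(b) = aa`, extended to words by concatenation.  For `n ≥ 0`
let `Wₙ = (σⁿ(a))''` be the word `σⁿ(a)` with its last letter removed.  Then for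
every `n ≥ 0` we have `W_{n+1} = Wₙ, εₙ, Wₙ` where `εₙ = a` if `n` is even and
`εₙ = b` if `n` is odd. -/
theorem pd_word_palindromic_structure
    {X : Type*} (a b : X) (hab : a ≠ b) (σ : X → List X)
    (hσa : σ a = [a, b]) (hσb : σ b = [a, a])
    (W : ℕ → List X)
    (hW : ∀ n, W n = ((fun l : List X => l.flatMap σ)^[n] [a]).dropLast) :
    ∀ n : ℕ, W (n + 1) = W n ++ (if Even n then a else b) :: W n := by
  intro n
  obtain ⟨P, ha, hb⟩ := exists_common_prefix_iterate_flatMap a b σ hσa hσb n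
  have hsucc : (fun l : List X => l.flatMap σ)^[n + 1] [a] =
      (P ++ (if Even n then a else b) :: P) ++ [if Even n then b else a] := by
    have hab' : [a].flatMap σ = [a] ++ [b] := by simp [hσa]
    rw [Function.iterate_succ_apply, hab', List.iterate_flatMap_append, ha, hb]
    simp
  rw [hW, hW, hsucc, ha, List.dropLast_concat, List.dropLast_concat]
end

section
/- For every n ≥ 0, the word W_n is a palindrome: W_n = W_n*, where W* denotes the reversal of the word W. -/
/-- If `τ` maps every letter of `l` to a two-letter word beginning with `a`, then reversing
`l.flatMap τ ++ [a]` amounts to reversing `l`. -/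
theorem reverse_flatMap_append_singleton {X : Type*} {a : X} {τ : X → List X} {l : List X}
    (h : ∀ c ∈ l, ∃ d, τ c = [a, d]) :
    (l.flatMap τ ++ [a]).reverse = l.reverse.flatMap τ ++ [a] := by
  induction l with
  | nil => simp
  | cons c t ih =>
    obtain ⟨d, hd⟩ := h c (by simp)
    calc ((c :: t).flatMap τ ++ [a]).reverse
        = (t.flatMap τ ++ [a]).reverse ++ [d, a] := by simp [hd]
      _ = (t.reverse.flatMap τ ++ [a]) ++ [d, a] := by
        rw [ih fun x hx => h x (List.mem_cons_of_mem c hx)]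
      _ = (c :: t).reverse.flatMap τ ++ [a] := by simp [hd]

/-- Every iterate of the period-doubling morphism on `a` is a palindrome over `{a, b}` followed
by a single letter of `{a, b}`. -/
theorem exists_palindrome_append_singleton_eq_iterate {X : Type*} {a b : X} {σ : X → List X}
    (hσa : σ a = [a, b]) (hσb : σ b = [a, a]) (n : ℕ) :
    ∃ (p : List X) (x : X), (fun l : List X => l.flatMap σ)^[n] [a] = p ++ [x] ∧
      (∀ c ∈ p ++ [x], c = a ∨ c = b) ∧ p.reverse = p := by
  induction n with
  | zero => exact ⟨[], a, by simp⟩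
  | succ n ih =>
    obtain ⟨p, x, hpx, hmem, hp⟩ := ih
    have hσ : ∀ c ∈ p ++ [x], ∃ d, σ c = [a, d] ∧ (d = a ∨ d = b) := by
      intro c hc
      rcases hmem c hc with rfl | rfl
      · exact ⟨b, hσa, Or.inr rfl⟩
      · exact ⟨a, hσb, Or.inl rfl⟩
    obtain ⟨y, hy, -⟩ := hσ x (by simp)
    have hflat : (p ++ [x]).flatMap σ = (p.flatMap σ ++ [a]) ++ [y] := by simp [hy]
    refine ⟨p.flatMap σ ++ [a], y, ?_, ?_, ?_⟩
    · rw [Function.iterate_succ_apply', hpx, hflat]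
    · intro c hc
      rw [← hflat, List.mem_flatMap] at hc
      obtain ⟨e, he, hce⟩ := hc
      obtain ⟨d, hd, hdab⟩ := hσ e he
      rw [hd] at hce
      simp only [List.mem_cons, List.not_mem_nil, or_false] at hce
      rcases hce with rfl | rfl
      · exact Or.inl rfl
      · exact hdab
    · rw [reverse_flatMap_append_singleton, hp]
      intro c hc
      obtain ⟨d, hd, -⟩ := hσ c (by simp [hc])
      exact ⟨d, hd⟩

/-- Let `{a, b}` be a two-letter alphabet and `σ` the morphism with
`σ(a) = ab`, `σ(b) = aa`, extended to words by concatenation.  For `n ≥ 0` let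
`Wₙ = (σⁿ(a))''` be the word `σⁿ(a)` with its last letter removed.  Then for
every `n ≥ 0` the word `Wₙ` is a palindrome: `Wₙ = Wₙ*`, where `W*` denotes
the reversal of `W`. -/
theorem pd_word_is_palindrome
    {X : Type*} (a b : X) (hab : a ≠ b) (σ : X → List X)
    (hσa : σ a = [a, b]) (hσb : σ b = [a, a])
    (W : ℕ → List X)
    (hW : ∀ n, W n = ((fun l : List X => l.flatMap σ)^[n] [a]).dropLast) :
    ∀ n : ℕ, (W n).reverse = W n := by
  intro n
  obtain ⟨p, x, hpx, -, hp⟩ := exists_palindrome_append_singleton_eq_iterate hσa hσb n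
  rw [hW, hpx, List.dropLast_concat, hp]
end
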